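/- Let W be the 7×7 matrix over Z[a,b,c,d] given row by row as: row 1 = (0, 1, a+b, (a+b)(b+c), (a+b)(b+c)d + (a+b)bc, (a+b)bcd, ab²cd); row 2 = (ab²cd, 0, 1, b+c, b(c+d)+cd, bcd, b²cd); row 3 = ((a+b)bcd, ab²cd, 0, 1, c+d, cd, bcd); row 4 = ((a+b)(b+c)d, ab(b+c)d, ab²cd, 0, 1, d, (b+c)d); row 5 = ((a+b)(b+c+d), ab(b+c+d), ab²(c+d), ab²cd, 0, 1, b+c+d); row 6 = (a+b, ab, ab², ab²c, ab²cd, 0, 1); row 7 = (1, a, ab, ab(b+c), ab(b+c)d + ab²c, ab²cd, 0). Then det W = (1 + a³b²cd)(1 + ab²c³d)(1 + ab²cd³)(1 + ab⁴cd + (ab⁴cd)²). -/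

import Mathlib

open MvPolynomial

theorem hept_aux_N {R : Type*} [CommRing R] (a b c d : R) :
    (!![a * b ^ 2 * c * d, 1, b + c, b ^ 2 * c * d;
      (a + b) * b * c * d, 0, 1, b * c * d;
      a + b, a * b ^ 2, a * b ^ 2 * c, 1;
      1, a * b, a * b * (b + c), 0] : Matrix (Fin 4) (Fin 4) R).det =
      -(1 + a * b ^ 4 * c * d + (a * b ^ 4 * c * d) ^ 2) := by
  simp [Matrix.det_succ_row_zero, Fin.sum_univ_succ, Fin.succAbove]
  ring

theorem hept_aux_Q {R : Type*} [CommRing R] (a c d : R) :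
    (!![1, -a, 0, 0, 0, 0, 0;
      0, 1, 0, 0, 0, 0, 0;
      0, 0, 1, 0, c ^ 2, 0, 0;
      0, 0, 0, 1, -(c + d), d ^ 2, 0;
      0, 0, 0, 0, 1, -d, 0;
      0, 0, 0, 0, 0, 1, 0;
      0, a ^ 2, 0, 0, 0, 0, 1] : Matrix (Fin 7) (Fin 7) R).det = 1 := by
  rw [Matrix.det_succ_column _ 0]
  simp [Matrix.det_succ_row_zero, Fin.sum_univ_succ, Fin.succAbove]

theorem hept_aux_M {R : Type*} [CommRing R] (a b c d : R) :
    (!![0, 1 + a ^ 2 * (a * b ^ 2 * c * d), a + b, (a + b) * (b + c), 0, 0, a * b ^ 2 * c * d;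
      a * b ^ 2 * c * d, 0, 1, b + c, 0, 0, b ^ 2 * c * d;
      (a + b) * b * c * d, 0, 0, 1, 0, 0, b * c * d;
      (a + b) * (b + c) * d, 0, a * b ^ 2 * c * d, 0, 1 + c ^ 2 * (a * b ^ 2 * c * d), 0, (b + c) * d;
      (a + b) * (b + c + d), 0, a * b ^ 2 * (c + d), a * b ^ 2 * c * d, -(c + d) * (a * b ^ 2 * c * d) + c ^ 2 * (a * b ^ 2 * (c + d)), 1 + d ^ 2 * (a * b ^ 2 * c * d), b + c + d;
      a + b, 0, a * b ^ 2, a * b ^ 2 * c, 0, 0, 1;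
      1, 0, a * b, a * b * (b + c), 0, 0, 0] : Matrix (Fin 7) (Fin 7) R).det =
    (1 + a ^ 3 * b ^ 2 * c * d) * (1 + a * b ^ 2 * c ^ 3 * d) *
      (1 + a * b ^ 2 * c * d ^ 3) *
      (1 + a * b ^ 4 * c * d + (a * b ^ 4 * c * d) ^ 2) := by
  have h := hept_aux_N a b c d
  rw [Matrix.det_succ_column _ 1, Finset.sum_eq_single 0]
  rotate_left
  · intro i _ hi
    fin_cases i <;> simp at hi ⊢
  · simp
  rw [Matrix.det_succ_column _ 4, Finset.sum_eq_single 3]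
  rotate_left
  · intro i _ hi
    fin_cases i <;> simp [Fin.succAbove] at hi ⊢
  · simp
  rw [Matrix.det_succ_column _ 3, Finset.sum_eq_single 2]
  rotate_left
  · intro i _ hi
    fin_cases i <;> simp [Fin.succAbove] at hi ⊢
  · simp
  rw [show (Matrix.submatrix (Matrix.submatrix (Matrix.submatrix _ _ _) _ _) _ _ : Matrix (Fin 4) (Fin 4) R) = _ from ?_, h]
  rotate_left
  · ext i j
    fin_cases i <;> fin_cases j <;> rfl
  simp [Fin.succAbove]
  ring

/-- **Determinant of the weight matrix of the dissected heptagon example.**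
With `a, b, c, d` the indeterminates attached to the three triangles and the
quadrangle of the dissected `7`-gon, the explicitly given `7×7` weight matrix `W`
has determinant `(1 + a³b²cd)(1 + ab²c³d)(1 + ab²cd³)(1 + ab⁴cd + (ab⁴cd)²)`. -/
theorem heptagon_weight_matrix_det
    (a b c d : MvPolynomial (Fin 4) ℤ)
    (ha : a = X 0) (hb : b = X 1) (hc : c = X 2) (hd : d = X 3)
    (W : Matrix (Fin 7) (Fin 7) (MvPolynomial (Fin 4) ℤ))
    (hW : W = Matrix.of
      ![![0, 1, a + b, (a + b) * (b + c), (a + b) * (b + c) * d + (a + b) * b * c,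
          (a + b) * b * c * d, a * b ^ 2 * c * d],
        ![a * b ^ 2 * c * d, 0, 1, b + c, b * (c + d) + c * d, b * c * d, b ^ 2 * c * d],
        ![(a + b) * b * c * d, a * b ^ 2 * c * d, 0, 1, c + d, c * d, b * c * d],
        ![(a + b) * (b + c) * d, a * b * (b + c) * d, a * b ^ 2 * c * d, 0, 1, d,
          (b + c) * d],
        ![(a + b) * (b + c + d), a * b * (b + c + d), a * b ^ 2 * (c + d),
          a * b ^ 2 * c * d, 0, 1, b + c + d],
        ![a + b, a * b, a * b ^ 2, a * b ^ 2 * c, a * b ^ 2 * c * d, 0, 1],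
        ![1, a, a * b, a * b * (b + c), a * b * (b + c) * d + a * b ^ 2 * c,
          a * b ^ 2 * c * d, 0]]) :
    W.det = (1 + a ^ 3 * b ^ 2 * c * d) * (1 + a * b ^ 2 * c ^ 3 * d) *
      (1 + a * b ^ 2 * c * d ^ 3) *
      (1 + a * b ^ 4 * c * d + (a * b ^ 4 * c * d) ^ 2) := by
  clear ha hb hc hd
  have hQ := hept_aux_Q a c d
  have hM := hept_aux_M a b c d
  rw [← hM]
  refine ((mul_one W.det).symm.trans (congrArg (W.det * ·) hQ.symm)).trans ?_
  beta_reduce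
  rw [← Matrix.det_mul]
  congr 1
  rw [hW]
  ext1 i j
  fin_cases i <;> fin_cases j <;> simp [Matrix.mul_apply, Fin.sum_univ_succ] <;> ring
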